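/- arXiv:quant-ph/0405013 — 2 statements merged into one kernel-verified Lean document; each statement's English description precedes it below -/
import Mathlib

section
/- (Sharper upper bound lemma) For every integer n ≥ 1, limsup_{m→∞} (lowdeg Q_n(m))/m ≤ 1.19. -/
open Polynomial Filter

/-- The on-site energy polynomial `ε_n(α) = (−1)^n − Σ_{k=2}^{n+1} (−1)^{⌊n/k⌋} α^{k−1}` in `ℤ[α]`. -/
noncomputable def eps (n : ℕ) : Polynomial ℤ :=
  C ((-1 : ℤ) ^ n) - ∑ k ∈ Finset.Icc 2 (n + 1), C ((-1 : ℤ) ^ (n / k)) * X ^ (k - 1)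

/-- `Q_n(m) = ∏_{s=1}^m (ε_{n+s}(α) − ε_n(α))`. -/
noncomputable def Q (n m : ℕ) : Polynomial ℤ :=
  ∏ s ∈ Finset.Icc 1 m, (eps (n + s) - eps n)

/-- `lowdeg P`: the multiplicity of the root `α = 0`, i.e. the least `i` with nonzero
coefficient of `α^i`. -/
noncomputable def lowdeg (P : Polynomial ℤ) : ℕ := P.natTrailingDegree

/-- `h_{n,m}(i)`: the number of `s` with `1 ≤ s ≤ m` such that
`lowdeg (ε_{n+s} − ε_n) > i`. -/
noncomputable def hcount (n m i : ℕ) : ℕ :=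
  ((Finset.Icc 1 m).filter (fun s => i < lowdeg (eps (n + s) - eps n))).card

/-- `⌊N/j⌋` and `⌊n/j⌋` have the same parity for all `1 ≤ j ≤ k`. -/
def FloorParityAgree (n k N : ℕ) : Prop :=
  ∀ j, 1 ≤ j → j ≤ k → N / j % 2 = n / j % 2

/-- The integers satisfying `P` occupy at most `a` residue classes modulo `M`. -/
def ResidueCover (P : ℕ → Prop) (M a : ℕ) : Prop :=
  ∃ A : Finset ℕ, A.card ≤ a ∧ ∀ N, P N → N % M ∈ A

lemma FloorParityAgree.mono {n k l N : ℕ} (h : FloorParityAgree n l N) (hkl : k ≤ l) :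
    FloorParityAgree n k N :=
  fun j h1 h2 => h j h1 (h2.trans hkl)

lemma modEq_two_pow_of_div_parity {x y b : ℕ}
    (h : ∀ j ≤ b, x / 2 ^ j % 2 = y / 2 ^ j % 2) : x % 2 ^ (b + 1) = y % 2 ^ (b + 1) := by
  induction b with
  | zero => simpa using h 0 le_rfl
  | succ b ih =>
    have h1 := ih fun j hj => h j (by omega)
    have h2 := h (b + 1) le_rfl
    rw [pow_succ 2 (b + 1), Nat.mod_mul, Nat.mod_mul, h1, h2]

lemma FloorParityAgree.div_mod_two_pow {n k N q b : ℕ} (h : FloorParityAgree n k N)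
    (hq : 1 ≤ q) (hk : q * 2 ^ b ≤ k) : N / q % 2 ^ (b + 1) = n / q % 2 ^ (b + 1) := by
  refine modEq_two_pow_of_div_parity fun j hj => ?_
  rw [Nat.div_div_eq_div_mul, Nat.div_div_eq_div_mul]
  refine h _ (Nat.mul_pos hq (by positivity)) (le_trans ?_ hk)
  gcongr
  norm_num

lemma FloorParityAgree.mod_two_pow {n k N b : ℕ} (h : FloorParityAgree n k N)
    (hk : 2 ^ b ≤ k) : N % 2 ^ (b + 1) = n % 2 ^ (b + 1) := by
  simpa using h.div_mod_two_pow (q := 1) le_rfl (by simpa using hk)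

lemma FloorParityAgree.mod_eq {n k N q b : ℕ} (h : FloorParityAgree n k N)
    (hq : 1 ≤ q) (hqb : q ≤ 2 ^ (b + 1)) (hk : q * 2 ^ b ≤ k) : N % q = n % q := by
  have h1 : N / q ≡ n / q [MOD 2 ^ (b + 1)] := h.div_mod_two_pow hq hk
  have h2 : N ≡ n [MOD 2 ^ (b + 1)] :=
    h.mod_two_pow ((Nat.le_mul_of_pos_left _ hq).trans hk)
  have h3 : N % q ≡ n % q [MOD 2 ^ (b + 1)] := by
    refine Nat.ModEq.add_left_cancel (h1.mul_left q) ?_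
    rwa [Nat.div_add_mod, Nat.div_add_mod]
  exact h3.eq_of_lt_of_lt ((Nat.mod_lt _ hq).trans_le hqb) ((Nat.mod_lt _ hq).trans_le hqb)

lemma residueCover_two_pow {n k : ℕ} (b : ℕ) (hk : 2 ^ b ≤ k) :
    ResidueCover (FloorParityAgree n k) (2 ^ (b + 1)) 1 :=
  ⟨{n % 2 ^ (b + 1)}, by simp, fun _ h => by simpa using h.mod_two_pow hk⟩

lemma residueCover_determined {n k : ℕ} (q b : ℕ) (hq : 1 ≤ q) (hqb : q ≤ 2 ^ (b + 1))
    (hk : q * 2 ^ b ≤ k) : ResidueCover (FloorParityAgree n k) q 1 :=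
  ⟨{n % q}, by simp, fun _ h => by simpa using h.mod_eq hq hqb hk⟩

/-- For odd `q`, the parity of `N % q` is determined by those of `N` and `N / q`. -/
lemma residueCover_odd {n k : ℕ} (r : ℕ) (hk : 2 * r + 1 ≤ k) :
    ResidueCover (FloorParityAgree n k) (2 * r + 1) (r + 1) := by
  refine ⟨(Finset.range (r + 1)).image fun t => 2 * t + (n + n / (2 * r + 1)) % 2,
    Finset.card_image_le.trans (by simp), fun N h => ?_⟩
  have h1 : N % 2 = n % 2 := by simpa using h 1 le_rfl (by omega)
  have h2 := h (2 * r + 1) (by omega) hk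
  have h3 := Nat.mod_lt N (show 0 < 2 * r + 1 by omega)
  have h4 := Nat.div_add_mod N (2 * r + 1)
  have h5 : (2 * r + 1) * (N / (2 * r + 1)) =
      2 * (r * (N / (2 * r + 1))) + N / (2 * r + 1) := by ring
  rw [h5] at h4
  generalize r * (N / (2 * r + 1)) = w at h4
  simp only [Finset.mem_image, Finset.mem_range]
  exact ⟨N % (2 * r + 1) / 2, by omega, by omega⟩

lemma ResidueCover.mul {P : ℕ → Prop} {M M' a a' : ℕ} (h : ResidueCover P M a)
    (h' : ResidueCover P M' a') (hM : M.Coprime M') : ResidueCover P (M * M') (a * a') := by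
  obtain ⟨A, hA, hPA⟩ := h
  obtain ⟨B, hB, hPB⟩ := h'
  refine ⟨(A ×ˢ B).image fun p => (Nat.chineseRemainder hM p.1 p.2 : ℕ) % (M * M'),
    Finset.card_image_le.trans ?_, fun N hN => ?_⟩
  · rw [Finset.card_product]
    exact Nat.mul_le_mul hA hB
  · refine Finset.mem_image.2 ⟨(N % M, N % M'),
      Finset.mem_product.2 ⟨hPA N hN, hPB N hN⟩, ?_⟩
    have hc := (Nat.chineseRemainder hM (N % M) (N % M')).2
    exact (Nat.modEq_and_modEq_iff_modEq_mul hM).1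
      ⟨hc.1.trans (Nat.mod_modEq _ _), hc.2.trans (Nat.mod_modEq _ _)⟩

open Classical in
lemma ResidueCover.card_filter_le {P : ℕ → Prop} {M a : ℕ} (h : ResidueCover P M a)
    (n m : ℕ) :
    ((((Finset.Icc 1 m).filter fun s => P (n + s)).card : ℕ) : ℝ) ≤ a / M * m + a := by
  obtain ⟨A, hA, hPA⟩ := h
  have hsub : ((Finset.Icc 1 m).filter fun s => P (n + s)).card ≤ A.card * (m / M + 1) := by
    rw [← Finset.card_range (m / M + 1), ← Finset.card_product]
    refine Finset.card_le_card_of_injOn (fun s => ((n + s) % M, (s - 1) / M)) ?_ ?_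
    · intro s hs
      simp only [Finset.coe_filter, Finset.mem_Icc, Set.mem_ofPred_eq] at hs
      simp only [Finset.coe_product, Set.mem_prod, Finset.mem_coe, Finset.mem_range]
      exact ⟨hPA _ hs.2, Nat.lt_succ_of_le (Nat.div_le_div_right (by omega))⟩
    · intro s hs t ht hst
      simp only [Finset.coe_filter, Finset.mem_Icc, Set.mem_ofPred_eq] at hs ht
      simp only [Prod.mk.injEq] at hst
      have h1 : n + s ≡ n + t [MOD M] := hst.1
      have h2 : (n + 1) + (s - 1) ≡ (n + 1) + (t - 1) [MOD M] := by
        convert h1 using 1 <;> omega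
      have h3 : (s - 1) % M = (t - 1) % M := Nat.ModEq.add_left_cancel' _ h2
      have h4 := Nat.div_add_mod (s - 1) M
      rw [hst.2, h3, Nat.div_add_mod] at h4
      omega
  have hA' : (A.card : ℝ) ≤ a := by exact_mod_cast hA
  have hdiv : ((m / M : ℕ) : ℝ) ≤ m / M := Nat.cast_div_le
  calc ((((Finset.Icc 1 m).filter fun s => P (n + s)).card : ℕ) : ℝ)
      ≤ A.card * ((m / M : ℕ) + 1) := by exact_mod_cast hsub
    _ ≤ a * (m / M + 1) := by gcongr
    _ = a / M * m + a := by ring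

open Classical in
/-- Up to a bounded error, the number of pairs `(k, s)` with `u ≤ k < v`, `1 ≤ s ≤ m` and
`n + s` agreeing with `n` up to `k` is at most `c * m`. -/
def BlockBound (n u v : ℕ) (c : ℝ) : Prop :=
  ∃ K : ℝ, ∀ m : ℕ, (∑ k ∈ Finset.Ico u v,
    (((Finset.Icc 1 m).filter fun s => FloorParityAgree n k (n + s)).card : ℝ)) ≤ c * m + K

lemma BlockBound.append {n u v w : ℕ} {c d : ℝ} (h : BlockBound n u v c)
    (h' : BlockBound n v w d) (huv : u ≤ v) (hvw : v ≤ w) : BlockBound n u w (c + d) := by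
  obtain ⟨K, hK⟩ := h
  obtain ⟨K', hK'⟩ := h'
  refine ⟨K + K', fun m => ?_⟩
  rw [← Finset.sum_Ico_consecutive _ huv hvw]
  linarith [hK m, hK' m]

lemma BlockBound.mono {n u v : ℕ} {c d : ℝ} (h : BlockBound n u v c) (hcd : c ≤ d) :
    BlockBound n u v d := by
  obtain ⟨K, hK⟩ := h
  exact ⟨K, fun m => (hK m).trans (by gcongr)⟩

lemma ResidueCover.blockBound {n u M a : ℕ} (h : ResidueCover (FloorParityAgree n u) M a)
    (l : ℕ) : BlockBound n u (u + l) (l * (a / M)) := by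
  classical
  refine ⟨l * a, fun m => ?_⟩
  have hk : ∀ k ∈ Finset.Ico u (u + l),
      (((Finset.Icc 1 m).filter fun s => FloorParityAgree n k (n + s)).card : ℝ) ≤
        a / M * m + a := by
    intro k hk
    refine le_trans ?_ (h.card_filter_le n m)
    refine Nat.cast_le.2 (Finset.card_le_card (Finset.monotone_filter_right _ ?_))
    exact fun s _ hs => FloorParityAgree.mono hs (Finset.mem_Ico.1 hk).1
  refine (Finset.sum_le_card_nsmul _ _ _ hk).trans (le_of_eq ?_)
  simp
  ring

lemma blockBound_one_thirtyTwo (n : ℕ) : BlockBound n 1 32 (1.1416 : ℝ) := by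
  have h1 := (residueCover_two_pow (n := n) (k := 1) 0 (by norm_num)).blockBound 1
  have h2 := (residueCover_two_pow (n := n) (k := 2) 1 (by norm_num)).blockBound 1
  have h3 := ((residueCover_two_pow (n := n) (k := 3) 1 (by norm_num)).mul
    (residueCover_odd 1 (by norm_num)) (by norm_num)).blockBound 1
  have h4 := ((residueCover_two_pow (n := n) (k := 4) 2 (by norm_num)).mul
    (residueCover_odd 1 (by norm_num)) (by norm_num)).blockBound 1
  have h5 := (((residueCover_two_pow (n := n) (k := 5) 2 (by norm_num)).mul
    (residueCover_odd 1 (by norm_num)) (by norm_num)).mul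
    (residueCover_odd 2 (by norm_num)) (by norm_num)).blockBound 1
  have base (k b : ℕ) (hb : 2 ^ b ≤ k) (hk : 6 ≤ k) :
      ResidueCover (FloorParityAgree n k) (2 ^ (b + 1) * 3 * 5) (1 * 1 * 3) :=
    ((residueCover_two_pow b hb).mul (residueCover_determined 3 1 (by norm_num) (by norm_num) hk)
      (Nat.Coprime.pow_left _ (by norm_num))).mul (residueCover_odd 2 (by omega))
      (Nat.Coprime.mul_left (Nat.Coprime.pow_left _ (by norm_num)) (by norm_num))
  have h6 := (base 6 2 (by norm_num) (by norm_num)).blockBound 1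
  have h7 := ((base 7 2 (by norm_num) (by norm_num)).mul
    (residueCover_odd 3 (by norm_num)) (by norm_num)).blockBound 1
  have h8 := ((base 8 3 (by norm_num) (by norm_num)).mul
    (residueCover_odd 3 (by norm_num)) (by norm_num)).blockBound 3
  have h11 := (((base 11 3 (by norm_num) (by norm_num)).mul
    (residueCover_odd 3 (by norm_num)) (by norm_num)).mul
    (residueCover_odd 5 (by norm_num)) (by norm_num)).blockBound 2
  have h13 := ((((base 13 3 (by norm_num) (by norm_num)).mul
    (residueCover_odd 3 (by norm_num)) (by norm_num)).mul
    (residueCover_odd 5 (by norm_num)) (by norm_num)).mul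
    (residueCover_odd 6 (by norm_num)) (by norm_num)).blockBound 3
  have h16 := ((((base 16 4 (by norm_num) (by norm_num)).mul
    (residueCover_odd 3 (by norm_num)) (by norm_num)).mul
    (residueCover_odd 5 (by norm_num)) (by norm_num)).mul
    (residueCover_odd 6 (by norm_num)) (by norm_num)).blockBound 16
  have h := (((((((((h1.append h2 (by norm_num) (by norm_num)).append
    h3 (by norm_num) (by norm_num)).append h4 (by norm_num) (by norm_num)).append
    h5 (by norm_num) (by norm_num)).append h6 (by norm_num) (by norm_num)).append
    h7 (by norm_num) (by norm_num)).append h8 (by norm_num) (by norm_num)).append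
    h11 (by norm_num) (by norm_num)).append h13 (by norm_num) (by norm_num)).append
    h16 (by norm_num) (by norm_num)
  exact h.mono (by norm_num)

lemma residueCover_two_pow_sub {n k : ℕ} (J a : ℕ) (hJ : 2 ≤ J) (ha : 2 * J + 1 ≤ a)
    (hk : 2 ^ a ≤ k) :
    ResidueCover (FloorParityAgree n k)
      (2 ^ (a + 1) * (2 ^ (J + 1) - 1) * (2 ^ (J + 1) - 3)) 1 := by
  have h8 : 8 ≤ 2 ^ (J + 1) :=
    le_trans (by norm_num) (Nat.pow_le_pow_right (n := 2) (by norm_num) (by omega : 3 ≤ J + 1))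
  have hpow : 2 ^ (J + 1) * 2 ^ J ≤ k := by
    rw [← pow_add]
    exact (Nat.pow_le_pow_right (by norm_num) (by omega)).trans hk
  have heven : 2 ^ (J + 1) = 2 * 2 ^ J := by ring
  have hq (t : ℕ) (ht : t < 2 ^ (J + 1)) :
      ResidueCover (FloorParityAgree n k) (2 ^ (J + 1) - t) 1 :=
    residueCover_determined _ J (by omega) (by omega)
      ((Nat.mul_le_mul_right _ (Nat.sub_le _ _)).trans hpow)
  have hodd (t : ℕ) (ht : t % 2 = 1) (ht' : t < 2 ^ (J + 1)) :
      Nat.Coprime 2 (2 ^ (J + 1) - t) := by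
    rw [Nat.coprime_two_left, Nat.odd_iff]
    omega
  have hcop : Nat.Coprime (2 ^ (J + 1) - 1) (2 ^ (J + 1) - 3) := by
    have h2 : 2 ^ (J + 1) - 1 = 2 + (2 ^ (J + 1) - 3) := by omega
    rw [h2, Nat.coprime_add_self_left]
    exact hodd 3 (by norm_num) (by omega)
  simpa using ((residueCover_two_pow a hk).mul (hq 1 (by omega))
    ((hodd 1 (by norm_num) (by omega)).pow_left _)).mul (hq 3 (by omega))
    (Nat.Coprime.mul_left ((hodd 3 (by norm_num) (by omega)).pow_left _) hcop)

lemma blockBound_dyadic (n J a : ℕ) (hJ : 2 ≤ J) (ha : 2 * J + 1 ≤ a) :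
    BlockBound n (2 ^ a) (2 ^ (a + 1)) (32 / 35 / 4 ^ (J + 1)) := by
  have h8 : 8 ≤ 2 ^ (J + 1) :=
    le_trans (by norm_num) (Nat.pow_le_pow_right (n := 2) (by norm_num) (by omega : 3 ≤ J + 1))
  have h := (residueCover_two_pow_sub (n := n) J a hJ ha le_rfl).blockBound (2 ^ a)
  rw [← mul_two, ← pow_succ] at h
  refine h.mono ?_
  have h4 : (4 : ℝ) ^ (J + 1) = (2 ^ (J + 1)) ^ 2 := by
    rw [← pow_mul, mul_comm, pow_mul]
    norm_num
  have h8' : (8 : ℝ) ≤ 2 ^ (J + 1) := by exact_mod_cast h8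
  rw [h4]
  push_cast [Nat.cast_sub (by omega : 1 ≤ 2 ^ (J + 1)), Nat.cast_sub (by omega : 3 ≤ 2 ^ (J + 1))]
  rw [pow_succ 2 a]
  generalize (2 : ℝ) ^ (J + 1) = x at h8'
  have hx1 : 0 < x - 1 := by linarith
  have hx3 : 0 < x - 3 := by linarith
  have hy : (2 : ℝ) ^ a ≠ 0 := by positivity
  generalize (2 : ℝ) ^ a = y at hy
  have hyx : y * (1 / (y * 2 * (x - 1) * (x - 3))) = 1 / (2 * (x - 1) * (x - 3)) := by
    field_simp
  rw [hyx, div_div, div_le_div_iff₀ (by positivity) (by positivity)]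
  nlinarith

lemma blockBound_initial (n J : ℕ) (hJ : 2 ≤ J) :
    BlockBound n 1 (2 ^ (2 * J + 1)) (1.18 - 4 * (64 / 105) / 4 ^ (J + 1)) := by
  induction J, hJ using Nat.le_induction with
  | base => exact (blockBound_one_thirtyTwo n).mono (by norm_num)
  | succ J hJ ih =>
    have h := (ih.append (blockBound_dyadic n J (2 * J + 1) hJ le_rfl) Nat.one_le_two_pow
      (Nat.pow_le_pow_right (by norm_num) (by omega))).append
      (blockBound_dyadic n J (2 * J + 1 + 1) hJ (by omega)) Nat.one_le_two_pow
      (Nat.pow_le_pow_right (by norm_num) (by omega))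
    refine h.mono (le_of_eq ?_)
    rw [pow_succ 4 (J + 1)]
    field_simp
    ring

lemma coeff_eps {n i : ℕ} (hi : i ≤ n) :
    (eps n).coeff i = if i = 0 then (-1) ^ n else -(-1) ^ (n / (i + 1)) := by
  have hterm : ∀ k ∈ Finset.Icc 2 (n + 1),
      (C ((-1 : ℤ) ^ (n / k)) * X ^ (k - 1)).coeff i =
        if k = i + 1 then (-1) ^ (n / (i + 1)) else 0 := by
    intro k hk
    have hk2 := (Finset.mem_Icc.1 hk).1
    rw [coeff_C_mul_X_pow]
    by_cases h : k = i + 1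
    · subst h
      simp
    · rw [if_neg h, if_neg (by omega)]
  rw [eps, coeff_sub, finsetSum_coeff, Finset.sum_congr rfl hterm, Finset.sum_ite_eq', coeff_C]
  by_cases h : i = 0
  · simp [h]
  · rw [if_neg h, if_neg h, if_pos (Finset.mem_Icc.2 (by omega)), zero_sub]

lemma coeff_eps_of_lt {n i : ℕ} (hi : n < i) : (eps n).coeff i = 0 := by
  rw [eps, coeff_sub, finsetSum_coeff, coeff_C, if_neg (by omega), zero_sub, neg_eq_zero]
  refine Finset.sum_eq_zero fun k hk => ?_
  have hk2 := Finset.mem_Icc.1 hk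
  rw [coeff_C_mul_X_pow, if_neg (by omega)]

lemma coeff_eps_sub_ne_zero {n s : ℕ} (hs : 1 ≤ s) : (eps (n + s) - eps n).coeff (n + 1) ≠ 0 := by
  rw [coeff_sub, coeff_eps_of_lt (Nat.lt_succ_self n), coeff_eps (by omega)]
  simp

lemma eps_sub_ne_zero {n s : ℕ} (hs : 1 ≤ s) : eps (n + s) - eps n ≠ 0 := fun h =>
  coeff_eps_sub_ne_zero (n := n) hs (by simp [h])

lemma lowdeg_eps_sub_le {n s : ℕ} (hs : 1 ≤ s) : lowdeg (eps (n + s) - eps n) ≤ n + 1 :=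
  natTrailingDegree_le_of_ne_zero (coeff_eps_sub_ne_zero hs)

lemma floorParityAgree_of_le_lowdeg {n s k : ℕ} (hk : k ≤ n + 1)
    (h : k ≤ lowdeg (eps (n + s) - eps n)) : FloorParityAgree n k (n + s) := by
  intro j h1 h2
  have hc := coeff_eq_zero_of_lt_natTrailingDegree
    (show j - 1 < (eps (n + s) - eps n).natTrailingDegree from
      lt_of_lt_of_le (by omega) h)
  rw [coeff_sub, sub_eq_zero, coeff_eps (by omega), coeff_eps (by omega), Nat.sub_add_cancel h1] at hc
  have hpow : (-1 : ℤ) ^ ((n + s) / j) = (-1) ^ (n / j) := by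
    by_cases hj : j = 1
    · subst hj
      simpa using hc
    · simpa [show j - 1 ≠ 0 by omega] using hc
  rcases Nat.mod_two_eq_zero_or_one ((n + s) / j) with hx | hx <;>
  rcases Nat.mod_two_eq_zero_or_one (n / j) with hy | hy <;>
  rw [neg_one_pow_eq_pow_mod_two, hx, neg_one_pow_eq_pow_mod_two (n / j), hy] at hpow <;>
  simp_all

lemma lowdeg_Q (n m : ℕ) :
    lowdeg (Q n m) = ∑ s ∈ Finset.Icc 1 m, lowdeg (eps (n + s) - eps n) := by
  induction m with
  | zero => simp [Q, lowdeg]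
  | succ m ih =>
    have hne : Q n m ≠ 0 :=
      Finset.prod_ne_zero_iff.2 fun s hs => eps_sub_ne_zero (Finset.mem_Icc.1 hs).1
    have hQ : Q n (m + 1) = Q n m * (eps (n + (m + 1)) - eps n) :=
      Finset.prod_Icc_succ_top (by omega) _
    rw [Finset.sum_Icc_succ_top (by omega), ← ih, hQ]
    exact natTrailingDegree_mul hne (eps_sub_ne_zero (by omega))

open Classical in
lemma lowdeg_Q_le_sum_card (n m : ℕ) :
    lowdeg (Q n m) ≤ ∑ k ∈ Finset.Ico 1 (n + 2),
      ((Finset.Icc 1 m).filter fun s => FloorParityAgree n k (n + s)).card := by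
  simp_rw [Finset.card_filter]
  rw [lowdeg_Q, Finset.sum_comm]
  refine Finset.sum_le_sum fun s hs => ?_
  have hle := lowdeg_eps_sub_le (n := n) (Finset.mem_Icc.1 hs).1
  rw [← Finset.card_filter]
  calc lowdeg (eps (n + s) - eps n)
      = (Finset.Ico 1 (lowdeg (eps (n + s) - eps n) + 1)).card := by simp
    _ ≤ _ := Finset.card_le_card fun k hk => by
      rw [Finset.mem_Ico] at hk
      exact Finset.mem_filter.2 ⟨Finset.mem_Ico.2 (by omega),
        floorParityAgree_of_le_lowdeg (by omega) (by omega)⟩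

lemma exists_lowdeg_Q_le (n : ℕ) : ∃ K : ℝ, ∀ m : ℕ, (lowdeg (Q n m) : ℝ) ≤ 1.18 * m + K := by
  classical
  obtain ⟨K, hK⟩ := (blockBound_initial n (n + 2) (by omega)).mono
    (sub_le_self _ (by positivity))
  refine ⟨K, fun m => le_trans ?_ (hK m)⟩
  have hn : n + 2 ≤ 2 ^ (2 * (n + 2) + 1) :=
    Nat.lt_two_pow_self.le.trans (Nat.pow_le_pow_right (by norm_num) (by omega))
  calc (lowdeg (Q n m) : ℝ) ≤ ∑ k ∈ Finset.Ico 1 (n + 2),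
        (((Finset.Icc 1 m).filter fun s => FloorParityAgree n k (n + s)).card : ℝ) := by
        exact_mod_cast lowdeg_Q_le_sum_card n m
    _ ≤ _ := Finset.sum_le_sum_of_subset_of_nonneg (Finset.Ico_subset_Ico_right hn)
      fun _ _ _ => Nat.cast_nonneg _

theorem lowdeg_Q_limsup_sharper_upper_bound (n : ℕ) (hn : 1 ≤ n) :
    limsup (fun m : ℕ => (lowdeg (Q n m) : ℝ) / m) atTop ≤ (1.19 : ℝ) := by
  obtain ⟨K, hK⟩ := exists_lowdeg_Q_le n
  refine limsup_le_of_le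
    (isCoboundedUnder_le_of_le atTop (x := 0) fun m => by positivity) ?_
  filter_upwards [eventually_ge_atTop (⌈100 * K⌉₊ + 1)] with m hm
  have hm' : 100 * K ≤ m :=
    (Nat.le_ceil _).trans (by exact_mod_cast (Nat.le_succ _).trans hm)
  have hpos : (0 : ℝ) < m := by exact_mod_cast (by omega : 0 < m)
  rw [div_le_iff₀ hpos]
  linarith [hK m]
end

section
/- (Erdős) For every integer M > 6 there exists a prime p with M < p < 2M and p ≡ 1 (mod 4), and there exists a prime q with M < q < 2M and q ≡ 3 (mod 4). -/
open Finset Real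
open scoped ArithmeticFunction.vonMangoldt Chebyshev

namespace PrimesModFour

/-- The sum of `log n` over the positive integers `n ≤ N` with `n ≡ r (mod 4)`. -/
noncomputable def logSum (r N : ℕ) : ℝ := ∑ n ∈ Ioc 0 N with n % 4 = r, log n

/-- The number of positive integers `m ≤ t` with `m ≡ r (mod 4)`. -/
def residueCount (r t : ℕ) : ℕ := #{m ∈ Ioc 0 t | m % 4 = r}

lemma sum_Ioc_filter_mod_four (g : ℕ → ℝ) {r : ℕ} (hr : r = 1 ∨ r = 3) (N : ℕ) :
    ∑ n ∈ Ioc 0 N with n % 4 = r, g n = ∑ j ∈ range ((N + 4 - r) / 4), g (4 * j + r) := by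
  induction N with
  | zero => rcases hr with rfl | rfl <;> simp
  | succ N ih =>
    rw [sum_filter] at ih ⊢
    rw [sum_Ioc_succ_top (Nat.zero_le N), ih]
    split_ifs with h
    · rw [show (N + 1 + 4 - r) / 4 = (N + 4 - r) / 4 + 1 by omega, sum_range_succ]
      congr 2
      omega
    · rw [show (N + 1 + 4 - r) / 4 = (N + 4 - r) / 4 by omega, add_zero]

lemma residueCount_eq {r : ℕ} (hr : r = 1 ∨ r = 3) (t : ℕ) :
    residueCount r t = (t + 4 - r) / 4 := by
  have h := sum_Ioc_filter_mod_four (fun _ ↦ 1) hr t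
  simp only [sum_const, card_range, nsmul_eq_mul, mul_one] at h
  exact_mod_cast h

/-! ### Estimating `logSum` -/

lemma mul_log_sub_increment {y : ℝ} (hy : 0 < y) :
    4 * log y ≤ ((y + 4) * log (y + 4) - (y + 4)) - (y * log y - y) ∧
      ((y + 4) * log (y + 4) - (y + 4)) - (y * log y - y) ≤ 4 * log (y + 4) := by
  have h1 : log (y + 4) - log y ≤ 4 / y := by
    rw [← log_div (by positivity) hy.ne']
    have := log_le_sub_one_of_pos (show 0 < (y + 4) / y by positivity)
    have e : (y + 4) / y - 1 = 4 / y := by field_simp; ring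
    linarith
  have h2 : log y - log (y + 4) ≤ - (4 / (y + 4)) := by
    rw [← log_div hy.ne' (by positivity)]
    have := log_le_sub_one_of_pos (show 0 < y / (y + 4) by positivity)
    have e : y / (y + 4) - 1 = -(4 / (y + 4)) := by field_simp; ring
    linarith
  have h3 : y * (log (y + 4) - log y) ≤ 4 := by
    calc _ ≤ y * (4 / y) := by gcongr
      _ = 4 := by field_simp
  have h4 : (y + 4) * (log y - log (y + 4)) ≤ -4 := by
    calc _ ≤ (y + 4) * (-(4 / (y + 4))) := by gcongr
      _ = -4 := by field_simp
  constructor <;> linarith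

lemma mul_log_sub_mono {x y : ℝ} (hx : 1 ≤ x) (hxy : x ≤ y) :
    x * log x - x ≤ y * log y - y := by
  have hx0 : 0 < x := by linarith
  have hy0 : 0 < y := by linarith
  have h := log_le_sub_one_of_pos (show 0 < x / y by positivity)
  rw [log_div hx0.ne' hy0.ne'] at h
  have h1 : y * (log x - log y) ≤ x - y := by
    calc _ ≤ y * (x / y - 1) := by gcongr
      _ = x - y := by field_simp
  nlinarith [log_nonneg hx]

lemma sum_log_progression_le (r k : ℕ) (hr : 0 < r) :
    4 * ∑ j ∈ range k, log ((4 * j + r : ℕ) : ℝ) ≤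
      ((4 * k + r : ℕ) * log ((4 * k + r : ℕ) : ℝ) - (4 * k + r : ℕ)) - (r * log r - r) := by
  induction k with
  | zero => simp
  | succ k ih =>
    have h := (mul_log_sub_increment (y := ((4 * k + r : ℕ) : ℝ)) (by positivity)).1
    rw [sum_range_succ, show (4 * (k + 1) + r : ℕ) = (4 * k + r) + 4 by ring,
      Nat.cast_add (4 * k + r) 4, Nat.cast_ofNat]
    linarith

lemma le_sum_log_progression (r k : ℕ) (hr : 0 < r) :
    ((4 * k + r : ℕ) * log ((4 * k + r : ℕ) : ℝ) - (4 * k + r : ℕ)) - (r * log r - r)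
      - 4 * log ((4 * k + r : ℕ) : ℝ) ≤ 4 * ∑ j ∈ range k, log ((4 * j + r : ℕ) : ℝ) := by
  induction k with
  | zero =>
    have : 0 ≤ log (r : ℝ) := log_natCast_nonneg r
    simpa using this
  | succ k ih =>
    have h := (mul_log_sub_increment (y := ((4 * k + r : ℕ) : ℝ)) (by positivity)).2
    rw [sum_range_succ, show (4 * (k + 1) + r : ℕ) = (4 * k + r) + 4 by ring,
      Nat.cast_add (4 * k + r) 4, Nat.cast_ofNat]
    linarith

lemma logSum_floor_le {r : ℕ} (hr : r = 1 ∨ r = 3) {x : ℝ} (hx : 1 ≤ x) :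
    4 * logSum r ⌊x⌋₊ ≤ x * log x - x + 4 * log x + 1 := by
  have hfl : (⌊x⌋₊ : ℝ) ≤ x := Nat.floor_le (by linarith)
  have hlog := log_nonneg hx
  have hr0 : 0 < r := by omega
  rw [logSum, sum_Ioc_filter_mod_four _ hr]
  rcases hk : (⌊x⌋₊ + 4 - r) / 4 with _ | k
  · have := mul_log_sub_mono le_rfl hx
    simp only [log_one] at this
    simp only [range_zero, sum_empty]
    linarith
  · have hle : ((4 * k + r : ℕ) : ℝ) ≤ x := by
      refine le_trans ?_ hfl
      exact_mod_cast (by omega : 4 * k + r ≤ ⌊x⌋₊)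
    have h1 : (1 : ℝ) ≤ (4 * k + r : ℕ) := by exact_mod_cast (by omega : 1 ≤ 4 * k + r)
    have hr1 : (1 : ℝ) ≤ r := by exact_mod_cast hr0
    have hmono := mul_log_sub_mono h1 hle
    have hr2 := mul_log_sub_mono le_rfl hr1
    have hl := log_le_log (by linarith) hle
    have := sum_log_progression_le r k hr0
    rw [log_one] at hr2
    rw [sum_range_succ]
    linarith

lemma le_logSum_floor {r : ℕ} (hr : r = 1 ∨ r = 3) {x : ℝ} (hx : 1 ≤ x) :
    x * log x - x - 4 * log (x + 4) - 1 ≤ 4 * logSum r ⌊x⌋₊ := by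
  have hfl : (⌊x⌋₊ : ℝ) ≤ x := Nat.floor_le (by linarith)
  have hfl' : x < (⌊x⌋₊ : ℝ) + 1 := Nat.lt_floor_add_one x
  have hr0 : 0 < r := by omega
  rw [logSum, sum_Ioc_filter_mod_four _ hr]
  generalize hk : (⌊x⌋₊ + 4 - r) / 4 = k
  have hle : x ≤ ((4 * k + r : ℕ) : ℝ) := by
    refine hfl'.le.trans ?_
    exact_mod_cast (by omega : ⌊x⌋₊ + 1 ≤ 4 * k + r)
  have hge : ((4 * k + r : ℕ) : ℝ) ≤ x + 4 := by
    have : ((4 * k + r : ℕ) : ℝ) ≤ (⌊x⌋₊ : ℝ) + 4 := by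
      exact_mod_cast (by omega : 4 * k + r ≤ ⌊x⌋₊ + 4)
    linarith
  have hmono := mul_log_sub_mono hx hle
  have hl := log_le_log (by linarith) hge
  have := le_sum_log_progression r k hr0
  have hr1 : (r : ℝ) * log r - r ≤ 1 := by
    rcases hr with rfl | rfl
    · simp
    · have h27 : log 3 * 3 ≤ log 2 * 5 := by
        have : log ((3 : ℝ) ^ 3) ≤ log ((2 : ℝ) ^ 5) := log_le_log (by norm_num) (by norm_num)
        rw [log_pow, log_pow] at this
        push_cast at this
        linarith
      have := log_two_lt_d9
      push_cast
      linarith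
  linarith

/-! ### Expressing `logSum` through the von Mangoldt function -/

lemma card_filter_dvd_mod_four (r N d : ℕ) (hd : 0 < d) :
    #{n ∈ Ioc 0 N | n % 4 = r ∧ d ∣ n} = #{m ∈ Ioc 0 (N / d) | (d * m) % 4 = r} := by
  symm
  rw [← card_image_of_injective (f := (d * ·)) _ (mul_right_injective₀ hd.ne')]
  congr 1
  ext n
  simp only [mem_filter, mem_Ioc, mem_image]
  constructor
  · rintro ⟨m, ⟨⟨h0, hN⟩, hr⟩, rfl⟩
    have := (Nat.le_div_iff_mul_le hd).1 hN
    exact ⟨⟨by positivity, by linarith⟩, hr, dvd_mul_right d m⟩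
  · rintro ⟨⟨h0, hN⟩, hr, m, rfl⟩
    exact ⟨m, ⟨⟨Nat.pos_of_mul_pos_left h0, (Nat.le_div_iff_mul_le hd).2 (by linarith)⟩, hr⟩, rfl⟩

lemma logSum_div_eq_sum_vonMangoldt (r X a : ℕ) :
    logSum r (X / a) =
      ∑ d ∈ Ioc 0 X, Λ d * (#{m ∈ Ioc 0 (X / d / a) | (d * m) % 4 = r} : ℕ) := by
  have hlog : ∀ n ∈ Ioc 0 (X / a), log n = ∑ d ∈ Ioc 0 X, if d ∣ n then Λ d else 0 := by
    intro n hn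
    rw [mem_Ioc] at hn
    have hX : n ≤ X := hn.2.trans (Nat.div_le_self X a)
    rw [← ArithmeticFunction.vonMangoldt_sum, ← sum_filter]
    refine sum_congr ?_ fun _ _ ↦ rfl
    ext d
    simp only [Nat.mem_divisors, mem_filter, mem_Ioc]
    exact ⟨fun h ↦ ⟨⟨Nat.pos_of_dvd_of_pos h.1 hn.1, (Nat.le_of_dvd hn.1 h.1).trans hX⟩, h.1⟩,
      fun h ↦ ⟨h.2, hn.1.ne'⟩⟩
  rw [logSum, sum_congr rfl fun n hn ↦ hlog n (mem_filter.1 hn).1, sum_comm]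
  refine sum_congr rfl fun d hd ↦ ?_
  rw [← sum_filter, sum_const, filter_filter, card_filter_dvd_mod_four r _ d (mem_Ioc.1 hd).1,
    Nat.div_right_comm, nsmul_eq_mul, mul_comm]

lemma card_mul_mod_four_same {r d : ℕ} (hr : r = 1 ∨ r = 3) (hd : d % 4 = r) (t : ℕ) :
    #{m ∈ Ioc 0 t | (d * m) % 4 = r} = residueCount 1 t := by
  unfold residueCount
  congr 1
  refine filter_congr fun m _ ↦ ?_
  rw [Nat.mul_mod, hd]
  have := Nat.mod_lt m (show 4 > 0 by norm_num)
  rcases hr with rfl | rfl <;> interval_cases m % 4 <;> simp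

lemma card_mul_mod_four_opposite {r d : ℕ} (hr : r = 1 ∨ r = 3) (hd : d % 4 = r) (t : ℕ) :
    #{m ∈ Ioc 0 t | (d * m) % 4 = 4 - r} = residueCount 3 t := by
  unfold residueCount
  congr 1
  refine filter_congr fun m _ ↦ ?_
  rw [Nat.mul_mod, hd]
  have := Nat.mod_lt m (show 4 > 0 by norm_num)
  rcases hr with rfl | rfl <;> interval_cases m % 4 <;> simp

lemma card_mul_mod_four_even {r d : ℕ} (hr : r = 1 ∨ r = 3) (hd : d % 2 = 0) (t : ℕ) :
    #{m ∈ Ioc 0 t | (d * m) % 4 = r} = 0 := by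
  rw [card_eq_zero, filter_eq_empty_iff]
  intro m _ h
  have : (d * m) % 2 = 0 := by rw [Nat.mul_mod, hd]; simp
  omega

lemma weight_same_le (t : ℕ) :
    (3 * residueCount 1 t : ℤ) - 3 * residueCount 1 (t / 2) - 2 * residueCount 1 (t / 3)
      - 3 * residueCount 3 (t / 3) + residueCount 3 (t / 6) ≤
      if t = 1 then 3 else
        (if 5 ≤ t then 1 else 0) + (if 10 ≤ t then 1 else 0) + (if 25 ≤ t then 1 else 0) := by
  simp only [residueCount_eq (Or.inl rfl), residueCount_eq (Or.inr rfl)]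
  obtain ⟨q, k, hk, rfl⟩ : ∃ q k, k < 24 ∧ t = 24 * q + k :=
    ⟨t / 24, t % 24, Nat.mod_lt _ (by norm_num), (Nat.div_add_mod t 24).symm⟩
  interval_cases k <;> split_ifs <;> omega

lemma weight_opposite_le (t : ℕ) :
    (3 * residueCount 3 t : ℤ) - 3 * residueCount 3 (t / 2) - 2 * residueCount 3 (t / 3)
      - 3 * residueCount 1 (t / 3) + residueCount 1 (t / 6) ≤
      (if 5 ≤ t then 1 else 0) + (if 10 ≤ t then 1 else 0) + (if 25 ≤ t then 1 else 0) := by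
  simp only [residueCount_eq (Or.inl rfl), residueCount_eq (Or.inr rfl)]
  obtain ⟨q, k, hk, rfl⟩ : ∃ q k, k < 24 ∧ t = 24 * q + k :=
    ⟨t / 24, t % 24, Nat.mod_lt _ (by norm_num), (Nat.div_add_mod t 24).symm⟩
  interval_cases k <;> split_ifs <;> omega

/-- The multiplicity of `Λ d` in `logCombination r X`, as a function of `t = X / d`. -/
def weight (r d t : ℕ) : ℤ :=
  3 * #{m ∈ Ioc 0 t | (d * m) % 4 = r} - 3 * #{m ∈ Ioc 0 (t / 2) | (d * m) % 4 = r}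
    - 2 * #{m ∈ Ioc 0 (t / 3) | (d * m) % 4 = r}
    - 3 * #{m ∈ Ioc 0 (t / 3) | (d * m) % 4 = 4 - r}
    + #{m ∈ Ioc 0 (t / 6) | (d * m) % 4 = 4 - r}

/-- A combination of values of `logSum` whose von Mangoldt weights are concentrated on
`X / 2 < d ≤ X`, `d ≡ r (mod 4)`. -/
noncomputable def logCombination (r X : ℕ) : ℝ :=
  3 * logSum r X - 3 * logSum r (X / 2) - 2 * logSum r (X / 3) - 3 * logSum (4 - r) (X / 3)
    + logSum (4 - r) (X / 6)

lemma logCombination_eq_sum (r X : ℕ) :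
    logCombination r X = ∑ d ∈ Ioc 0 X, Λ d * weight r d (X / d) := by
  have h1 := logSum_div_eq_sum_vonMangoldt r X 1
  simp only [Nat.div_one] at h1
  rw [logCombination, h1]
  simp only [logSum_div_eq_sum_vonMangoldt, mul_sum, ← sum_sub_distrib, ← sum_add_distrib]
  refine sum_congr rfl fun d _ ↦ ?_
  rw [weight]
  push_cast
  ring

lemma weight_le {r : ℕ} (hr : r = 1 ∨ r = 3) (d t : ℕ) :
    weight r d t ≤ if t = 1 ∧ d % 4 = r then 3 else
      (if 5 ≤ t then 1 else 0) + (if 10 ≤ t then 1 else 0) + (if 25 ≤ t then 1 else 0) := by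
  have hr' : 4 - r = 1 ∨ 4 - r = 3 := by omega
  have hcases : d % 4 = r ∨ d % 4 = 4 - r ∨ d % 2 = 0 := by omega
  rcases hcases with h | h | h
  · simp only [weight, card_mul_mod_four_same hr h, card_mul_mod_four_opposite hr h, h, and_true]
    exact weight_same_le t
  · have hopp := card_mul_mod_four_opposite hr' h
    rw [show 4 - (4 - r) = r by omega] at hopp
    simp only [weight, card_mul_mod_four_same hr' h, hopp, h]
    rw [if_neg (by omega)]
    exact weight_opposite_le t
  · simp only [weight, card_mul_mod_four_even hr h, card_mul_mod_four_even hr' h]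
    split_ifs <;> simp

lemma sum_prime_log_eq_theta (X a : ℕ) (ha : 0 < a) :
    ∑ d ∈ Ioc 0 X with d.Prime, (if a ≤ X / d then log d else 0) = θ ((X / a : ℕ) : ℝ) := by
  rw [Chebyshev.theta, Nat.floor_natCast, ← sum_filter, filter_filter]
  refine sum_congr ?_ fun _ _ ↦ rfl
  ext d
  simp only [mem_filter, mem_Ioc]
  constructor
  · rintro ⟨⟨h0, hX⟩, hp, h⟩
    rw [Nat.le_div_iff_mul_le h0, mul_comm, ← Nat.le_div_iff_mul_le ha] at h
    exact ⟨⟨h0, h⟩, hp⟩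
  · rintro ⟨⟨h0, h⟩, hp⟩
    refine ⟨⟨h0, h.trans (Nat.div_le_self X a)⟩, hp, ?_⟩
    rwa [Nat.le_div_iff_mul_le h0, mul_comm, ← Nat.le_div_iff_mul_le ha]

lemma theta_natDiv_le (X a : ℕ) : θ ((X / a : ℕ) : ℝ) ≤ log 4 * (X / a) := by
  refine (Chebyshev.theta_le_log4_mul_x (Nat.cast_nonneg _)).trans ?_
  gcongr
  exact Nat.cast_div_le

lemma logCombination_le {r M : ℕ} (hr : r = 1 ∨ r = 3) (hM : 0 < M)
    (hno : ∀ p : ℕ, p.Prime → M < p → p ≤ 2 * M → p % 4 ≠ r) :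
    logCombination r (2 * M) ≤
      17 / 25 * log 2 * (2 * M : ℕ) + 6 * √(2 * M : ℕ) * log (2 * M : ℕ) := by
  set X := 2 * M with hX
  have hprime : ∑ d ∈ Ioc 0 X with d.Prime, Λ d * weight r d (X / d) ≤
      θ ((X / 5 : ℕ) : ℝ) + θ ((X / 10 : ℕ) : ℝ) + θ ((X / 25 : ℕ) : ℝ) := by
    rw [← sum_prime_log_eq_theta X 5 (by norm_num), ← sum_prime_log_eq_theta X 10 (by norm_num),
      ← sum_prime_log_eq_theta X 25 (by norm_num), ← sum_add_distrib, ← sum_add_distrib]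
    refine sum_le_sum fun d hd ↦ ?_
    obtain ⟨hd, hp⟩ := mem_filter.1 hd
    rw [mem_Ioc] at hd
    have hlog : 0 ≤ log (d : ℝ) := log_natCast_nonneg d
    have hw := weight_le hr d (X / d)
    rw [if_neg] at hw
    · rw [ArithmeticFunction.vonMangoldt_apply_prime hp]
      have hw' : (weight r d (X / d) : ℝ) ≤ (if 5 ≤ X / d then 1 else 0)
          + (if 10 ≤ X / d then 1 else 0) + (if 25 ≤ X / d then 1 else 0) := by
        exact_mod_cast hw
      refine (mul_le_mul_of_nonneg_left hw' hlog).trans_eq ?_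
      simp only [mul_add, mul_ite, mul_one, mul_zero]
    · rintro ⟨h1, h2⟩
      have h3 : X < d * (X / d + 1) := Nat.lt_mul_div_succ X hd.1
      rw [h1] at h3
      exact hno d hp (by omega) hd.2 h2
  have hnonprime : ∑ d ∈ Ioc 0 X with ¬ d.Prime, Λ d * weight r d (X / d) ≤
      3 * (ψ (X : ℝ) - θ (X : ℝ)) := by
    rw [Chebyshev.psi_sub_theta_eq_sum_not_prime, Nat.floor_natCast, mul_sum]
    refine sum_le_sum fun d _ ↦ ?_
    have hw : weight r d (X / d) ≤ 3 := by
      refine (weight_le hr d (X / d)).trans ?_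
      split_ifs <;> norm_num
    have hw' : (weight r d (X / d) : ℝ) ≤ 3 := by exact_mod_cast hw
    rw [mul_comm 3]
    exact mul_le_mul_of_nonneg_left hw' ArithmeticFunction.vonMangoldt_nonneg
  have hpsi := Chebyshev.psi_sub_theta_le (x := (X : ℝ)) (by exact_mod_cast (by omega : 1 ≤ X))
  have h5 := theta_natDiv_le X 5
  have h10 := theta_natDiv_le X 10
  have h25 := theta_natDiv_le X 25
  have hlog4 : log 4 = 2 * log 2 := by
    rw [show (4 : ℝ) = 2 ^ 2 by norm_num, log_pow]
    norm_num
  rw [hlog4] at h5 h10 h25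
  rw [logCombination_eq_sum, ← sum_filter_add_sum_filter_not _ Nat.Prime]
  push_cast at h5 h10 h25
  linarith

lemma logSum_natDiv_le {r : ℕ} (hr : r = 1 ∨ r = 3) {X a : ℕ} (ha : 0 < a) (hX : a ≤ X) :
    4 * logSum r (X / a) ≤ X / a * (log X - log a) - X / a + 4 * log X + 1 := by
  have ha' : (1 : ℝ) ≤ a := by exact_mod_cast ha
  have hX' : (a : ℝ) ≤ X := by exact_mod_cast hX
  have h := logSum_floor_le hr (x := (X : ℝ) / a) ((one_le_div (by linarith)).2 hX')
  rw [Nat.floor_div_eq_div, log_div (by linarith) (by linarith)] at h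
  linarith [log_nonneg ha']

lemma le_logSum_natDiv {r : ℕ} (hr : r = 1 ∨ r = 3) {X a : ℕ} (ha : 0 < a) (hX : a ≤ X) :
    X / a * (log X - log a) - X / a - 4 * log (X + 4) - 1 ≤ 4 * logSum r (X / a) := by
  have ha' : (1 : ℝ) ≤ a := by exact_mod_cast ha
  have hX' : (a : ℝ) ≤ X := by exact_mod_cast hX
  have h := le_logSum_floor hr (x := (X : ℝ) / a) ((one_le_div (by linarith)).2 hX')
  rw [Nat.floor_div_eq_div, log_div (by linarith) (by linarith)] at h
  have hdiv : (X : ℝ) / a ≤ X := div_le_self (by linarith) ha'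
  have : log ((X : ℝ) / a + 4) ≤ log (X + 4) := log_le_log (by positivity) (by linarith)
  linarith

lemma le_logCombination {r X : ℕ} (hr : r = 1 ∨ r = 3) (hX : 6 ≤ X) :
    X * (4 / 3 * log 2 + 3 / 2 * log 3) - 48 * log (X + 4) - 12 ≤ 4 * logCombination r X := by
  have hr' : 4 - r = 1 ∨ 4 - r = 3 := by omega
  have h1 := le_logSum_natDiv hr (X := X) (a := 1) (by norm_num) (by omega)
  have h2 := logSum_natDiv_le hr (X := X) (a := 2) (by norm_num) (by omega)
  have h3 := logSum_natDiv_le hr (X := X) (a := 3) (by norm_num) (by omega)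
  have h3' := logSum_natDiv_le hr' (X := X) (a := 3) (by norm_num) (by omega)
  have h6 := le_logSum_natDiv hr' (X := X) (a := 6) (by norm_num) (by omega)
  have hlog6 : log 6 = log 2 + log 3 := by
    rw [← log_mul (by norm_num) (by norm_num)]
    norm_num
  have hX0 : (6 : ℝ) ≤ X := by exact_mod_cast hX
  have hmono : log (X : ℝ) ≤ log (X + 4) := log_le_log (by linarith) (by linarith)
  push_cast at h1 h2 h3 h3' h6
  rw [hlog6] at h6
  rw [Nat.div_one, log_one] at h1
  rw [logCombination]
  linarith

lemma logCombination_bounds_separated {x : ℝ} (hx : 2 ^ 18 ≤ x) :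
    4 * (17 / 25 * log 2 * x + 6 * √x * log x) <
      x * (4 / 3 * log 2 + 3 / 2 * log 3) - 48 * log (x + 4) - 12 := by
  have hs : 512 ≤ √x := le_sqrt_of_sq_le (by linarith)
  have hxs : x = √x ^ 2 := (sq_sqrt (by linarith)).symm
  set s := √x
  have hlog3 : 19 / 12 * log 2 ≤ log 3 := by
    have : log ((2 : ℝ) ^ 19) ≤ log ((3 : ℝ) ^ 12) := log_le_log (by norm_num) (by norm_num)
    rw [log_pow, log_pow] at this
    push_cast at this
    linarith
  have hlogx : log x = 2 * log s := by rw [hxs, log_pow]; norm_num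
  have hlogs : log s ≤ 9 * log 2 + s / 512 - 1 := by
    have h := log_le_sub_one_of_pos (show 0 < s / 512 by linarith)
    rw [log_div (by linarith) (by norm_num), show (512 : ℝ) = 2 ^ 9 by norm_num, log_pow] at h
    push_cast at h
    linarith
  have hlogx4 : log (x + 4) ≤ 2 * log s + log 2 := by
    rw [← hlogx, add_comm, add_comm _ (log 2), ← log_mul (by norm_num) (by positivity)]
    exact log_le_log (by linarith) (by linarith)
  have h2 := log_two_gt_d9
  have h2' := log_two_lt_d9
  have hlogs' : log s ≤ 5.239 + s / 512 := by linarith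
  have hmain : 0.68 * x ≤
      x * (4 / 3 * log 2 + 3 / 2 * log 3) - 4 * (17 / 25 * log 2 * x) := by
    have : 0.68 ≤ 4 / 3 * log 2 + 3 / 2 * log 3 - 4 * (17 / 25 * log 2) := by linarith
    nlinarith
  have hmul : s * log s ≤ s * (5.239 + s / 512) := by gcongr
  rw [hlogx]
  nlinarith

lemma exists_prime_mod_four_of_large {r M : ℕ} (hr : r = 1 ∨ r = 3) (hM : 2 ^ 17 ≤ M) :
    ∃ p : ℕ, p.Prime ∧ M < p ∧ p < 2 * M ∧ p % 4 = r := by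
  by_contra! hno
  have hub := logCombination_le hr (M := M) (by omega) fun p hp h1 h2 ↦ hno p hp h1
    (lt_of_le_of_ne h2 fun h ↦ Nat.not_prime_mul (by norm_num) (by omega) (h ▸ hp))
  have hlb := le_logCombination hr (X := 2 * M) (by omega)
  have hsep := logCombination_bounds_separated (x := (2 * M : ℕ))
    (by exact_mod_cast (by omega : 2 ^ 18 ≤ 2 * M))
  linarith

lemma exists_prime_one_mod_four_of_small {M : ℕ} (h6 : 6 < M) (hM : M < 2 ^ 17) :
    ∃ p : ℕ, p.Prime ∧ M < p ∧ p < 2 * M ∧ p % 4 = 1 := by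
  have hlist : ∀ p ∈ [13, 17, 29, 53, 101, 197, 389, 773, 1493, 2969, 5897, 11789, 23561, 47093,
      94169, 188333], p.Prime ∧ p % 4 = 1 := by
    norm_num
  have hex : ∃ p ∈ [13, 17, 29, 53, 101, 197, 389, 773, 1493, 2969, 5897, 11789, 23561, 47093,
      94169, 188333], M < p ∧ p < 2 * M := by
    simp only [List.mem_cons, List.not_mem_nil, or_false, exists_eq_or_imp, exists_eq_left]
    omega
  obtain ⟨p, hp, h1, h2⟩ := hex
  exact ⟨p, (hlist p hp).1, h1, h2, (hlist p hp).2⟩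

lemma exists_prime_three_mod_four_of_small {M : ℕ} (h6 : 6 < M) (hM : M < 2 ^ 17) :
    ∃ p : ℕ, p.Prime ∧ M < p ∧ p < 2 * M ∧ p % 4 = 3 := by
  have hlist : ∀ p ∈ [11, 19, 31, 59, 107, 211, 419, 827, 1627, 3251, 6491, 12979, 25951, 51899,
      103787, 207563], p.Prime ∧ p % 4 = 3 := by
    norm_num
  have hex : ∃ p ∈ [11, 19, 31, 59, 107, 211, 419, 827, 1627, 3251, 6491, 12979, 25951, 51899,
      103787, 207563], M < p ∧ p < 2 * M := by
    simp only [List.mem_cons, List.not_mem_nil, or_false, exists_eq_or_imp, exists_eq_left]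
    omega
  obtain ⟨p, hp, h1, h2⟩ := hex
  exact ⟨p, (hlist p hp).1, h1, h2, (hlist p hp).2⟩

end PrimesModFour

/-- (Erdős) For every integer `M > 6` there is a prime `p` with `M < p < 2M` and
`p ≡ 1 (mod 4)`, and a prime `q` with `M < q < 2M` and `q ≡ 3 (mod 4)`. -/
theorem erdos_primes_one_and_three_mod_four (M : ℕ) (hM : 6 < M) :
    (∃ p : ℕ, p.Prime ∧ M < p ∧ p < 2 * M ∧ p % 4 = 1) ∧
    (∃ q : ℕ, q.Prime ∧ M < q ∧ q < 2 * M ∧ q % 4 = 3) := by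
  rcases lt_or_ge M (2 ^ 17) with h | h
  · exact ⟨PrimesModFour.exists_prime_one_mod_four_of_small hM h,
      PrimesModFour.exists_prime_three_mod_four_of_small hM h⟩
  · exact ⟨PrimesModFour.exists_prime_mod_four_of_large (Or.inl rfl) h,
      PrimesModFour.exists_prime_mod_four_of_large (Or.inr rfl) h⟩
end
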